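/- Let G be a directed graph and suppose the pair (u, v) of distinct nodes satisfies conditions (a)–(e) of the less redundant weak superbubble definition with some component U. Let B be the weak superbubble component of (u, v) by the simplified definition. Then G[U]∖(v,u) = B, and (u, v) is separable and acyclic in the sense of the simplified definition. -/

import Mathlib

namespace BidirectedDoubling

/-- A signed node: a node together with a sign (`true` = `+`, `false` = `-`). -/
abbrev SNode (V : Type*) := V × Bool

/-- The opposite signed node `vα̂` of `vα`. -/
def opp {V : Type*} (x : SNode V) : SNode V := (x.1, !x.2)

/-- A bidirected graph on node type `V`, given by its set of bidirected edges,
which are unordered pairs of signed nodes. -/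
abbrev BEdges (V : Type*) := Set (Sym2 (SNode V))

/-- One step of a bidirected walk within the edge set `F`: a walk leaving `a` with
sign `a.2` and then leaving `b` with sign `b.2` uses the edge `{a, opp b}`. -/
def BStep {V : Type*} (F : BEdges V) (a b : SNode V) : Prop := s(a, opp b) ∈ F

/-- A bidirected walk within the edge set `F`: a sequence `v₁α₁, …, v_ℓα_ℓ` of signed
nodes with `{vᵢαᵢ, v_{i+1}α̂ᵢ₊₁} ∈ F` for all `1 ≤ i < ℓ`. -/
def IsBWalk {V : Type*} (F : BEdges V) (w : List (SNode V)) : Prop :=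
  List.Chain' (BStep F) w

/-- A bidirected path: a walk containing each node at most once
(for each node `w` at most one of `w+` and `w−` occurs, and at most once). -/
def IsBPath {V : Type*} (F : BEdges V) (w : List (SNode V)) : Prop :=
  IsBWalk F w ∧ (w.map Prod.fst).Nodup

/-- A bidirected `a`-`b`-path. -/
def IsBPathFrom {V : Type*} (F : BEdges V) (a b : SNode V) (w : List (SNode V)) : Prop :=
  IsBPath F w ∧ w.head? = some a ∧ w.getLast? = some b

/-- The list of edges used by a bidirected walk. -/
def bWalkEdges {V : Type*} (w : List (SNode V)) : List (Sym2 (SNode V)) :=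
  List.zipWith (fun a b => s(a, opp b)) w w.tail

/-- The edge set `F` contains a proper cycloid: a `vγ`-`vδ`-walk with at least one edge,
where the signs `γ` and `δ` may or may not be equal. -/
def HasProperCycloid {V : Type*} (F : BEdges V) : Prop :=
  ∃ w : List (SNode V), IsBWalk F w ∧ 2 ≤ w.length ∧
    ∃ a b : SNode V, w.head? = some a ∧ w.getLast? = some b ∧ a.1 = b.1

/-- Node set of the ultrabubble component of `{uα, vβ}` (simplified definition):
`u`, `v` and all nodes on `uα`-`vβ̂`-paths. -/
def ubNodes {V : Type*} (E : BEdges V) (u : V) (α : Bool) (v : V) (β : Bool) : Set V :=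
  {u, v} ∪ {x | ∃ w, IsBPathFrom E (u, α) (v, !β) w ∧ x ∈ w.map Prod.fst}

/-- Edge set of the ultrabubble component of `{uα, vβ}` (simplified definition):
all edges on `uα`-`vβ̂`-paths. -/
def ubEdges {V : Type*} (E : BEdges V) (u : V) (α : Bool) (v : V) (β : Bool) : BEdges V :=
  {e | ∃ w, IsBPathFrom E (u, α) (v, !β) w ∧ e ∈ bWalkEdges w}

/-- Separability of `{uα, vβ}` in the simplified ultrabubble definition: every signed
node `wγ` contained in an edge of `E` outside the ultrabubble component `B` satisfies
`w ∉ V(B)`, or `wγ = uα̂`, or `wγ = vβ̂`. -/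
def UBSeparable {V : Type*} (E : BEdges V) (u : V) (α : Bool) (v : V) (β : Bool) : Prop :=
  ∀ e ∈ E, e ∉ ubEdges E u α v β →
    ∀ x : SNode V, x ∈ e →
      x.1 ∉ ubNodes E u α v β ∨ x = (u, !α) ∨ x = (v, !β)

/-- Acyclicity of `{uα, vβ}` in the simplified ultrabubble definition:
the ultrabubble component contains no proper cycloid. -/
def UBAcyclic {V : Type*} (E : BEdges V) (u : V) (α : Bool) (v : V) (β : Bool) : Prop :=
  ¬ HasProperCycloid (ubEdges E u α v β)

/-- `{uα, vβ}` is an ultrabubble by the simplified definition. -/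
def IsUltrabubbleSimp {V : Type*} (E : BEdges V) (u : V) (α : Bool) (v : V) (β : Bool) :
    Prop :=
  u ≠ v ∧ UBSeparable E u α v β ∧ UBAcyclic E u α v β ∧
  ¬ ∃ (w : V) (γ : Bool), w ∈ ubNodes E u α v β ∧ w ≠ u ∧ w ≠ v ∧
    (UBSeparable E u α w γ ∧ UBAcyclic E u α w γ) ∧
    (UBSeparable E w (!γ) v β ∧ UBAcyclic E w (!γ) v β)

section
open Classical

/-- Image of a signed node under splitting the signed nodes `uα` and `vβ`:
the signed node `uα̂` is replaced by `u′α̂` and `vβ̂` by `v′β̂`, where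
`Sum.inr false` plays the role of the new node `u′` and `Sum.inr true` of `v′`. -/
noncomputable def splitSN {V : Type*} (u : V) (α : Bool) (v : V) (β : Bool)
    (x : SNode V) : SNode (V ⊕ Bool) :=
  if x = (u, !α) then (Sum.inr false, !α)
  else if x = (v, !β) then (Sum.inr true, !β)
  else (Sum.inl x.1, x.2)

end

/-- The edge set of the graph obtained from `E` by splitting `uα` and `vβ`. -/
noncomputable def splitEdges {V : Type*} (E : BEdges V) (u : V) (α : Bool) (v : V)
    (β : Bool) : BEdges (V ⊕ Bool) :=
  (Sym2.map (splitSN u α v β)) '' E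

/-- Undirected adjacency (ignoring signs) within an edge set. -/
def bAdj {W : Type*} (F : BEdges W) (x y : W) : Prop :=
  ∃ γ δ : Bool, s((x, γ), (y, δ)) ∈ F

/-- Connectivity in the graph obtained by splitting `uα` and `vβ`. -/
def splitReach {V : Type*} (E : BEdges V) (u : V) (α : Bool) (v : V) (β : Bool)
    (x y : V ⊕ Bool) : Prop :=
  Relation.ReflTransGen (bAdj (splitEdges E u α v β)) x y

/-- `{uα, vβ}` is separable (original definition): the graph obtained by splitting
`uα` and `vβ` has a connected component containing `u` and `v` but neither `u′` nor `v′`. -/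
def SeparableOrig {V : Type*} (E : BEdges V) (u : V) (α : Bool) (v : V) (β : Bool) : Prop :=
  splitReach E u α v β (Sum.inl u) (Sum.inl v) ∧
  ¬ splitReach E u α v β (Sum.inl u) (Sum.inr false) ∧
  ¬ splitReach E u α v β (Sum.inl u) (Sum.inr true)

/-- Node set of the ultrabubble component of `{uα, vβ}` by the original definition:
the connected component of `u` in the split graph (as nodes of `G`). -/
def origNodes {V : Type*} (E : BEdges V) (u : V) (α : Bool) (v : V) (β : Bool) : Set V :=
  {x | splitReach E u α v β (Sum.inl u) (Sum.inl x)}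

/-- Edge set of the ultrabubble component of `{uα, vβ}` by the original definition:
the edges of `E` lying (after splitting) in the connected component of `u`. -/
def origEdges {V : Type*} (E : BEdges V) (u : V) (α : Bool) (v : V) (β : Bool) : BEdges V :=
  {e | e ∈ E ∧ ∀ x : SNode (V ⊕ Bool), x ∈ Sym2.map (splitSN u α v β) e →
    splitReach E u α v β (Sum.inl u) x.1}

/-- A tip with respect to the edge set `F`: a node all of whose incident edges
meet it with the same sign. -/
def IsTip {V : Type*} (F : BEdges V) (x : V) : Prop :=
  (∀ e ∈ F, ((x, true) : SNode V) ∉ e) ∨ (∀ e ∈ F, ((x, false) : SNode V) ∉ e)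

/-- `{uα, vβ}` is an ultrabubble by the original definition: separable, tipless,
acyclic and minimal. -/
def IsUltrabubbleOrig {V : Type*} (E : BEdges V) (u : V) (α : Bool) (v : V) (β : Bool) :
    Prop :=
  u ≠ v ∧ SeparableOrig E u α v β ∧
  (∀ x ∈ origNodes E u α v β, x ≠ u → x ≠ v → ¬ IsTip (origEdges E u α v β) x) ∧
  ¬ HasProperCycloid (origEdges E u α v β) ∧
  ¬ ∃ (w : V) (γ : Bool), w ∈ origNodes E u α v β ∧ w ≠ u ∧ w ≠ v ∧
    SeparableOrig E u α w γ ∧ SeparableOrig E w (!γ) v β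

/-- A directed walk with respect to the arc relation `A`. -/
def IsDWalk {N : Type*} (A : N → N → Prop) (w : List N) : Prop := List.Chain' A w

/-- A directed `a`-`b`-path: a walk from `a` to `b` repeating no node. -/
def IsDPathFrom {N : Type*} (A : N → N → Prop) (a b : N) (w : List N) : Prop :=
  List.Chain' A w ∧ w.Nodup ∧ w.head? = some a ∧ w.getLast? = some b

/-- The arc relation `A` contains a proper cycle: a walk of length at least one
from a node to itself. -/
def HasProperCycle {N : Type*} (A : N → N → Prop) : Prop :=
  ∃ w : List N, List.Chain' A w ∧ 2 ≤ w.length ∧ w.head? = w.getLast?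

/-- Gärtner et al.'s `U_{uv}`: the nodes reachable from `u` by a path not
passing through `v` (except possibly as its last node). -/
def Uout {N : Type*} (A : N → N → Prop) (u v : N) : Set N :=
  {x | ∃ w, IsDPathFrom A u x w ∧ v ∉ w.dropLast}

/-- Gärtner et al.'s `U⁺_{vu}`: the nodes from which `v` is reachable by a path not
passing through `u` (except possibly as its first node). -/
def Uin {N : Type*} (A : N → N → Prop) (u v : N) : Set N :=
  {x | ∃ w, IsDPathFrom A x v w ∧ u ∉ w.tail}

/-- Conditions (c), (d) and (e), common to both the Gärtner et al. and the less
redundant weak superbubble definitions. -/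
def WSBCondsCDE {N : Type*} (A : N → N → Prop) (U : Set N) (u v : N) : Prop :=
  (∀ x ∈ U, ∀ y ∉ U, ∀ w, IsDPathFrom A y x w → u ∈ w) ∧
  (∀ x ∈ U, ∀ y ∉ U, ∀ w, IsDPathFrom A x y w → v ∈ w) ∧
  (∀ x y, A x y → x ∈ U → y ∈ U → ∀ w, IsDPathFrom A y x w → u ∈ w ∧ v ∈ w)

/-- Conditions (a)–(e) of Gärtner et al.'s weak superbubble definition. -/
def WSBCondsOrig {N : Type*} (A : N → N → Prop) (U : Set N) (u v : N) : Prop :=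
  (∀ x ∈ U, ∃ w, IsDPathFrom A u x w) ∧
  (∀ x ∈ U, ∃ w, IsDPathFrom A x v w) ∧
  WSBCondsCDE A U u v

/-- `(u, v)` is a weak superbubble with component `U` by Gärtner et al.'s definition. -/
def IsWSBOrig {N : Type*} (A : N → N → Prop) (u v : N) (U : Set N) : Prop :=
  u ∈ U ∧ v ∈ U ∧ U = Uout A u v ∧ U = Uin A u v ∧
  WSBCondsOrig A U u v ∧
  ¬ ∃ v' ∈ U, v' ≠ u ∧ v' ≠ v ∧ ∃ U' : Set N, u ∈ U' ∧ v' ∈ U' ∧ WSBCondsOrig A U' u v'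

/-- Conditions (a)–(e) of the less redundant weak superbubble definition. -/
def WSBCondsLR {N : Type*} (A : N → N → Prop) (U : Set N) (u v : N) : Prop :=
  (∀ x ∈ U, ∃ w, IsDPathFrom A u x w ∧ v ∉ w.dropLast) ∧
  (∀ x ∈ U, ∃ w, IsDPathFrom A x v w ∧ u ∉ w.tail) ∧
  WSBCondsCDE A U u v

/-- `(u, v)` is a weak superbubble with component `U` by the less redundant definition. -/
def IsWSBLR {N : Type*} (A : N → N → Prop) (u v : N) (U : Set N) : Prop :=
  u ∈ U ∧ v ∈ U ∧ WSBCondsLR A U u v ∧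
  ¬ ∃ v' ∈ U, v' ≠ u ∧ v' ≠ v ∧ ∃ U' : Set N, u ∈ U' ∧ v' ∈ U' ∧ WSBCondsLR A U' u v'

/-- Node set of the weak superbubble component of `(u, v)` (simplified definition):
`u`, `v` and all nodes on `u`-`v`-paths. -/
def sbNodes {N : Type*} (A : N → N → Prop) (u v : N) : Set N :=
  {u, v} ∪ {x | ∃ w, IsDPathFrom A u v w ∧ x ∈ w}

/-- Arc relation of the weak superbubble component of `(u, v)` (simplified definition):
all arcs on `u`-`v`-paths. -/
def sbArcs {N : Type*} (A : N → N → Prop) (u v : N) (a b : N) : Prop :=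
  ∃ w, IsDPathFrom A u v w ∧ (a, b) ∈ w.zip w.tail

/-- Separability of `(u, v)` in the simplified weak superbubble definition:
every arc of `A` not in the component `B` that is incident to a node of `V(B)`
is incoming to `u` or outgoing from `v`. -/
def SBSeparable {N : Type*} (A : N → N → Prop) (u v : N) : Prop :=
  ∀ a b, A a b → ¬ sbArcs A u v a b → (a ∈ sbNodes A u v ∨ b ∈ sbNodes A u v) →
    b = u ∨ a = v

/-- Acyclicity of `(u, v)` in the simplified weak superbubble definition:
the component contains no proper cycle. -/
def SBAcyclic {N : Type*} (A : N → N → Prop) (u v : N) : Prop :=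
  ¬ HasProperCycle (sbArcs A u v)

/-- `(u, v)` is a weak superbubble by the simplified definition. -/
def IsWSBSimp {N : Type*} (A : N → N → Prop) (u v : N) : Prop :=
  SBSeparable A u v ∧ SBAcyclic A u v ∧
  ¬ ∃ w ∈ sbNodes A u v, w ≠ u ∧ w ≠ v ∧
    (SBSeparable A u w ∧ SBAcyclic A u w) ∧ (SBSeparable A w v ∧ SBAcyclic A w v)

/-- The arc relation of the induced subgraph `G[U]` with the arc `(v, u)` removed. -/
def inducedMinus {N : Type*} (A : N → N → Prop) (U : Set N) (v u : N) (a b : N) : Prop :=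
  A a b ∧ a ∈ U ∧ b ∈ U ∧ (a, b) ≠ (v, u)

/-- The arc relation of the doubled graph of the bidirected graph with edge set `E`:
each bidirected edge `{xδ, yε}` yields the two arcs `(xδ, yε̂)` and `(yε, xδ̂)`. -/
def doubledArc {V : Type*} (E : BEdges V) (a b : SNode V) : Prop :=
  ∃ x y : SNode V, s(x, y) ∈ E ∧ ((a = x ∧ b = opp y) ∨ (a = y ∧ b = opp x))

end BidirectedDoubling

open BidirectedDoubling

theorem aux_reach {N : Type*} (A : N → N → Prop) (u : N) : ∀ (l : List N) (b : N),
    List.IsChain A (b :: l) → u ∉ l → ∀ z ∈ b :: l,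
    Relation.ReflTransGen (fun x y => A x y ∧ y ≠ u) b z := by
  intro l
  induction l with
  | nil => intro b _ _ z hz; simp at hz; subst hz; exact .refl
  | cons c l ih =>
    intro b hc hu z hz
    rw [List.isChain_cons_cons] at hc
    rw [List.mem_cons] at hz
    rcases hz with rfl | hz
    · exact .refl
    · simp only [List.mem_cons, not_or] at hu
      exact .head ⟨hc.1, fun e => hu.1 e.symm⟩ (ih c hc.2 hu.2 z hz)

theorem aux_path {N : Type*} (R : N → N → Prop) (a b : N)
    (h : Relation.ReflTransGen R a b) : ∃ w, IsDPathFrom R a b w := by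
  induction h using Relation.ReflTransGen.head_induction_on with
  | refl => exact ⟨[b], List.isChain_singleton b, by simp, rfl, rfl⟩
  | @head a c hac _ ih =>
    obtain ⟨w, hw1, hw2, hw3, hw4⟩ := ih
    by_cases ha : a ∈ w
    · obtain ⟨s, t, rfl⟩ := List.append_of_mem ha
      refine ⟨a :: t, ?_, ?_, by simp, ?_⟩
      · exact (List.isChain_append.1 hw1).2.1
      · exact (List.nodup_append.1 hw2).2.1
      · rw [List.getLast?_append] at hw4
        simpa [List.getLast?_cons] using hw4
    · cases w with
      | nil => simp at hw3
      | cons d w =>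
        simp at hw3
        subst hw3
        refine ⟨a :: d :: w, List.isChain_cons_cons.2 ⟨hac, hw1⟩, List.nodup_cons.2 ⟨ha, hw2⟩,
          by simp, by simpa [List.getLast?_cons_cons] using hw4⟩

theorem aux_mem {N : Type*} (R : N → N → Prop) : ∀ (l : List N) (b : N),
    List.IsChain R (b :: l) → ∀ z ∈ l, ∃ y, R y z := by
  intro l
  induction l with
  | nil => intro b _ z hz; simp at hz
  | cons c l ih =>
    intro b hc z hz
    rw [List.isChain_cons_cons] at hc
    rcases List.mem_cons.1 hz with rfl | hz
    · exact ⟨_, hc.1⟩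
    · exact ih c hc.2 z hz

/-- A reachability avoiding `u` yields a path avoiding `u`. -/
theorem aux_avoid {N : Type*} (R : N → N → Prop) (u a b : N) (hau : a ≠ u)
    (hR : ∀ x y, R x y → y ≠ u)
    (h : Relation.ReflTransGen R a b) : ∃ w, IsDPathFrom R a b w ∧ u ∉ w := by
  obtain ⟨w, hw⟩ := aux_path R a b h
  refine ⟨w, hw, fun hu => ?_⟩
  obtain ⟨hw1, hw2, hw3, hw4⟩ := hw
  cases w with
  | nil => simp at hu
  | cons d w =>
    simp at hw3
    subst hw3
    rcases List.mem_cons.1 hu with rfl | hu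
    · exact hau rfl
    · obtain ⟨y, hy⟩ := aux_mem R w d hw1 u hu
      exact hR _ _ hy rfl

theorem aux_zip {N : Type*} (R : N → N → Prop) : ∀ (w : List N) (a b : N),
    (a, b) ∈ w.zip w.tail → ∃ s t, w = s ++ a :: b :: t := by
  intro w
  induction w with
  | nil => intro a b h; simp at h
  | cons c w ih =>
    intro a b h
    cases w with
    | nil => simp at h
    | cons d w =>
      simp only [List.tail_cons, List.zip_cons_cons, List.mem_cons, Prod.mk.injEq] at h
      rcases h with ⟨rfl, rfl⟩ | h
      · exact ⟨[], w, rfl⟩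
      · obtain ⟨s, t, hst⟩ := ih a b h
        exact ⟨c :: s, t, by rw [hst]; rfl⟩

theorem aux_zip' {N : Type*} (s t : List N) (a b : N) :
    (a, b) ∈ (s ++ a :: b :: t).zip (s ++ a :: b :: t).tail := by
  induction s with
  | nil => simp
  | cons c s ih =>
    cases s with
    | nil => simp
    | cons d s =>
      simp only [List.cons_append, List.tail_cons, List.zip_cons_cons, List.mem_cons]
      right
      simpa using ih

/-- If the pair `(u, v)` of distinct nodes satisfies conditions (a)–(e)
of the less redundant weak superbubble definition with some component `U`, then
`G[U] ∖ (v, u) = B` where `B` is the simplified weak superbubble component, and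
`(u, v)` is separable and acyclic in the sense of the simplified definition. -/
theorem wsb_lr_conds_to_simp {N : Type*} (A : N → N → Prop) (u v : N) (U : Set N)
    (huv : u ≠ v) (hu : u ∈ U) (hv : v ∈ U) (h : WSBCondsLR A U u v) :
    (U = sbNodes A u v ∧ (∀ a b, inducedMinus A U v u a b ↔ sbArcs A u v a b)) ∧
    SBSeparable A u v ∧ SBAcyclic A u v := by
  obtain ⟨ha, hb, hc, hd, he⟩ := h
  have no_in : ∀ a b, sbArcs A u v a b → b ≠ u := by
    rintro a b ⟨w, ⟨h1, h2, h3, h4⟩, hz⟩ rfl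
    obtain ⟨s, t, rfl⟩ := aux_zip A w a b hz
    cases s with
    | nil => simp at h3; subst h3; simp at h2
    | cons d s =>
      simp at h3; subst h3; simp at h2
  have sbA : ∀ a b, sbArcs A u v a b → A a b := by
    rintro a b ⟨w, ⟨h1, h2, h3, h4⟩, hz⟩
    obtain ⟨s, t, rfl⟩ := aux_zip A w a b hz
    exact (List.isChain_cons_cons.1 (List.isChain_append.1 h1).2.1).1
  have sub : ∀ w, IsDPathFrom A u v w → ∀ x ∈ w, x ∈ U := by
    rintro w ⟨h1, h2, h3, h4⟩ x hx
    by_contra hxU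
    obtain ⟨s, t, rfl⟩ := List.append_of_mem hx
    have hm := hc v hv x hxU (x :: t) ⟨(List.isChain_append.1 h1).2.1,
      (List.nodup_append.1 h2).2.1, by simp, by
        rw [List.getLast?_append] at h4
        simpa [List.getLast?_cons] using h4⟩
    cases s with
    | nil => simp at h3; exact hxU (h3 ▸ hu)
    | cons d s =>
      simp only [List.cons_append, List.head?_cons, Option.some.injEq] at h3
      subst h3
      exact (List.nodup_cons.1 h2).1 (List.mem_append_right _ hm)
  have arcs : ∀ a b, inducedMinus A U v u a b → sbArcs A u v a b := by
    rintro a b ⟨hab, haU, hbU, hne⟩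
    obtain ⟨P, hP, hPv⟩ := ha a haU
    obtain ⟨Q, hQ, hQu⟩ := hb b hbU
    have hav : a ≠ v := by
      rintro rfl
      have h1 := (he a b hab haU hbU Q hQ).1
      apply hne
      obtain ⟨q1, q2, q3, q4⟩ := hQ
      cases Q with
      | nil => simp at h1
      | cons d Q =>
        simp at q3 hQu h1
        subst q3
        rcases h1 with h1 | h1
        · rw [h1]
        · exact absurd h1 hQu
    have hPv' : v ∉ P := by
      obtain ⟨p1, p2, p3, p4⟩ := hP
      intro hvP
      obtain ⟨P', rfl⟩ : ∃ P', P = P' ++ [a] := List.getLast?_eq_some_iff.1 p4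
      simp at hPv hvP
      rcases hvP with hvP | hvP
      · exact hPv hvP
      · exact hav hvP.symm
    have hbu : b ≠ u := by
      rintro rfl
      exact hPv' (he a b hab haU hbU P hP).2
    obtain ⟨p1, p2, p3, p4⟩ := hP
    obtain ⟨q1, q2, q3, q4⟩ := hQ
    obtain ⟨P', rfl⟩ : ∃ P', P = P' ++ [a] := List.getLast?_eq_some_iff.1 p4
    obtain ⟨Q', rfl⟩ : ∃ Q', Q = b :: Q' := by
      cases Q with
      | nil => simp at q3
      | cons d Q => simp at q3; subst q3; exact ⟨Q, rfl⟩
    simp only [List.tail_cons] at hQu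
    have hdisj : ∀ z ∈ P' ++ [a], z ∉ b :: Q' := by
      intro z hzP hzQ
      have r1 := aux_reach A u Q' b q1 hQu z hzQ
      have hzu : z ≠ u := by
        rintro rfl
        rcases List.mem_cons.1 hzQ with h | h
        · exact hbu h.symm
        · exact hQu h
      obtain ⟨s, t, hst⟩ := List.append_of_mem hzP
      rw [hst] at p1 p2 p3
      have hut : u ∉ t := by
        intro hut
        cases s with
        | nil => simp at p3; exact hzu p3
        | cons d s =>
          simp at p3; subst p3
          exact (List.nodup_cons.1 p2).1 (by simp [hut])
      have haz : a ∈ z :: t := by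
        have : (s ++ z :: t).getLast? = some a := by rw [← hst]; simp
        rw [List.getLast?_append] at this
        apply List.mem_of_getLast?
        simpa [List.getLast?_cons] using this
      have r2 := aux_reach A u t z (List.isChain_append.1 p1).2.1 hut a haz
      obtain ⟨w, ⟨w1, w2, w3, w4⟩, huw⟩ := aux_avoid _ u b a hbu (fun x y h => h.2) (r1.trans r2)
      exact huw (he a b hab haU hbU w ⟨w1.imp (fun _ _ h => h.1), w2, w3, w4⟩).1
    refine ⟨P' ++ a :: b :: Q', ⟨?_, ?_, ?_, ?_⟩, aux_zip' _ _ _ _⟩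
    · have : List.IsChain A ((P' ++ [a]) ++ (b :: Q')) := by
        rw [List.isChain_append]
        refine ⟨p1, q1, ?_⟩
        intro x hx y hy
        simp at hx hy
        subst hx; subst hy; exact hab
      rw [List.append_assoc] at this
      exact this
    · have : ((P' ++ [a]) ++ (b :: Q')).Nodup := by
        rw [List.nodup_append]
        refine ⟨p2, q2, ?_⟩
        rintro x hx y hy rfl
        exact hdisj x hx hy
      simpa using this
    · cases P' with
      | nil => simpa using p3
      | cons d P' => simpa using p3
    · rw [List.getLast?_append, List.getLast?_cons_cons, q4]; rfl
  have zmem : ∀ a b, sbArcs A u v a b → a ∈ U ∧ b ∈ U := by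
    rintro a b ⟨w, hw, hz⟩
    obtain ⟨s, t, rfl⟩ := aux_zip A w a b hz
    exact ⟨sub _ hw _ (by simp), sub _ hw _ (by simp)⟩
  have arcs' : ∀ a b, inducedMinus A U v u a b ↔ sbArcs A u v a b := by
    intro a b
    refine ⟨arcs a b, fun hs => ⟨sbA a b hs, (zmem a b hs).1, (zmem a b hs).2, ?_⟩⟩
    intro h
    simp only [Prod.mk.injEq] at h
    exact no_in a b hs h.2
  have nodes : U = sbNodes A u v := by
    ext x
    constructor
    · intro hx
      obtain ⟨P, ⟨p1, p2, p3, p4⟩, hPv⟩ := ha x hx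
      obtain ⟨P', rfl⟩ : ∃ P', P = P' ++ [x] := List.getLast?_eq_some_iff.1 p4
      rcases List.eq_nil_or_concat P' with rfl | ⟨P'', p, rfl⟩
      · simp at p3
        left; left; exact p3
      · have hpx : A p x := by
          have : List.IsChain A (P'' ++ p :: [x]) := by
            rw [List.concat_eq_append, List.append_assoc] at p1
            exact p1
          exact (List.isChain_cons_cons.1 (List.isChain_append.1 this).2.1).1
        simp at hPv
        by_cases hxu : x = u
        · left; left; exact hxu
        have hpne : p ≠ x := by
          rintro rfl
          rw [List.concat_eq_append, List.append_assoc] at p2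
          simpa using (List.nodup_append.1 p2).2.1
        have hpU : p ∈ U := by
          by_contra hpU
          have := hc x hx p hpU [p, x] ⟨List.isChain_pair.2 hpx, by simpa using hpne, by simp, by simp⟩
          simp at this
          rcases this with rfl | rfl
          · exact hpU hu
          · exact hxu rfl
        obtain ⟨w, hw, hz⟩ := arcs p x ⟨hpx, hpU, hx, fun e => hxu (by simp at e; exact e.2)⟩
        obtain ⟨s, t, rfl⟩ := aux_zip A w p x hz
        exact Or.inr ⟨_, hw, by simp⟩
    · rintro ((rfl | rfl) | ⟨w, hw, hx⟩)
      · exact hu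
      · exact hv
      · exact sub w hw x hx
  refine ⟨⟨nodes, arcs'⟩, ?_, ?_⟩
  · intro a b hab hn hor
    rw [← nodes, ← arcs'] at *
    by_cases haU : a ∈ U
    · by_cases hbU : b ∈ U
      · by_contra hcon
        push Not at hcon
        exact hn ⟨hab, haU, hbU, fun e => hcon.1 (by simp at e; exact e.2)⟩
      · right
        have hne : a ≠ b := by rintro rfl; exact hbU haU
        have := hd a haU b hbU [a, b] ⟨List.isChain_pair.2 hab, by simpa using hne, by simp, by simp⟩
        simp at this
        rcases this with h | h
        · exact h.symm
        · exact absurd (h ▸ hv) hbU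
    · have hbU : b ∈ U := hor.resolve_left haU
      left
      have hne : a ≠ b := by rintro rfl; exact haU hbU
      have := hc b hbU a haU [a, b] ⟨List.isChain_pair.2 hab, by simpa using hne, by simp, by simp⟩
      simp at this
      rcases this with h | h
      · exact absurd (h ▸ hu) haU
      · exact h.symm
  · rintro ⟨w, w1, w2, w3⟩
    match w, w1, w2, w3 with
    | x :: y :: l, w1, _, w3 =>
      obtain ⟨hxy, hch⟩ := List.isChain_cons_cons.1 w1
      rw [List.getLast?_cons_cons] at w3
      have hxm : x ∈ y :: l := List.mem_of_getLast? (by rw [← w3]; rfl)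
      have hul : u ∉ l := fun hul => by
        obtain ⟨z, hz⟩ := aux_mem _ l y hch u hul
        exact no_in _ _ hz rfl
      have r := aux_reach _ u l y hch hul x hxm
      obtain ⟨w, ⟨w1, w2, w3, w4⟩, huw⟩ :=
        aux_avoid _ u y x (no_in _ _ hxy) (fun _ _ h => h.2) r
      exact huw (he x y (sbA _ _ hxy) (zmem _ _ hxy).1 (zmem _ _ hxy).2 w
        ⟨w1.imp (fun _ _ h => sbA _ _ h.1), w2, w3, w4⟩).1
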